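/- arXiv:1911.10684 — 2 statements merged into one kernel-verified Lean document; each statement's English description precedes it below -/
import Mathlib

section
/- Fix an initial state s, a natural number M, and a finite prefix of actions a_0, …, a_{M-1}, and let s_M be the state reached from s after applying this prefix. Then the supremum, over all action sequences a : ℕ → A extending this prefix (a(t) = a_t for t < M), of the tail sum ∑_{t=M}^∞ γ^t R(s_{t+1}, a_t) along the trajectory from s, equals γ^M · V*(s_M). -/
/-- The controlled trajectory: `traj f s a 0 = s` and
`traj f s a (t+1) = f (traj f s a t) (a t)`. -/
def traj {S A : Type*} (f : S → A → S) (s : S) (a : ℕ → A) : ℕ → S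
  | 0 => s
  | t + 1 => f (traj f s a t) (a t)

/-- The discounted return `G(s, a) = ∑ₜ γ^t R(s_{t+1}, a_t)`. -/
noncomputable def ret {S A : Type*} (f : S → A → S) (R : S → A → ℝ) (γ : ℝ)
    (s : S) (a : ℕ → A) : ℝ :=
  ∑' t : ℕ, γ ^ t * R (traj f s a (t + 1)) (a t)

/-- The optimal value function `V*(s) = ⨆ₐ G(s, a)`. -/
noncomputable def Vstar {S A : Type*} (f : S → A → S) (R : S → A → ℝ) (γ : ℝ)
    (s : S) : ℝ :=
  ⨆ a : ℕ → A, ret f R γ s a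

/-- Trajectories of action sequences that agree before time `M` agree at time `M`. -/
theorem traj_congr {S A : Type*} (f : S → A → S) (s : S) {a b : ℕ → A} {M : ℕ}
    (h : ∀ t < M, a t = b t) : traj f s a M = traj f s b M := by
  induction M with
  | zero => rfl
  | succ n ih =>
    simp only [traj]
    rw [ih fun t ht => h t (Nat.lt_succ_of_lt ht), h n (Nat.lt_succ_self n)]

/-- Semigroup property of trajectories: restarting at time `M` with the shifted actions. -/
theorem traj_add {S A : Type*} (f : S → A → S) (s : S) (a : ℕ → A) (M t : ℕ) :
    traj f s a (M + t) = traj f (traj f s a M) (fun n => a (M + n)) t := by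
  induction t with
  | zero => rfl
  | succ n ih =>
    rw [← Nat.add_assoc]
    simp only [traj]
    rw [ih]

/-- The tail of the discounted return from time `M` is `γ ^ M` times the return of the shifted
action sequence from the state reached at time `M`. -/
theorem tsum_tail_eq_pow_mul_ret {S A : Type*} (f : S → A → S) (R : S → A → ℝ) (γ : ℝ)
    (s : S) (a : ℕ → A) (M : ℕ) :
    ∑' t : ℕ, γ ^ (M + t) * R (traj f s a (M + t + 1)) (a (M + t))
      = γ ^ M * ret f R γ (traj f s a M) (fun n => a (M + n)) := by
  simp only [ret, ← tsum_mul_left, Nat.add_assoc, traj_add f s a M, pow_add, mul_assoc]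

/-- Every action sequence is the shift by `M` of a sequence with prescribed first `M` actions. -/
theorem shift_surjective {A : Type*} (M : ℕ) (p : ℕ → A) :
    Function.Surjective
      (fun (a : {a : ℕ → A // ∀ t < M, a t = p t}) (n : ℕ) => (a : ℕ → A) (M + n)) := by
  intro b
  refine ⟨⟨fun t => if t < M then p t else b (t - M), fun t ht => if_pos ht⟩, ?_⟩
  funext n
  simp

/-- Fixing an initial state `s` and the first `M` actions
(given by the prefix of `p`), the supremum over all action sequences extending this
prefix of the tail sum `∑_{t=M}^∞ γ^t R(s_{t+1}, a_t)` equals `γ^M ⬝ V*(s_M)`,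
where `s_M` is the state reached after the first `M` actions. -/
theorem tail_sup_eq_value {S A : Type*} [Nonempty A]
    (f : S → A → S) (R : S → A → ℝ) (γ C : ℝ)
    (hC : 0 ≤ C) (hR : ∀ s a, |R s a| ≤ C)
    (hγ0 : 0 ≤ γ) (hγ1 : γ < 1) (s : S) (M : ℕ) (p : ℕ → A) :
    (⨆ a : {a : ℕ → A // ∀ t < M, a t = p t},
        ∑' t : ℕ, γ ^ (M + t) * R (traj f s (a : ℕ → A) (M + t + 1)) ((a : ℕ → A) (M + t)))
      = γ ^ M * Vstar f R γ (traj f s p M) := by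
  rw [Vstar, Real.mul_iSup_of_nonneg (pow_nonneg hγ0 M)]
  refine (shift_surjective M p).iSup_congr _ fun a => ?_
  rw [tsum_tail_eq_pow_mul_ret, traj_congr f s a.2]
end

section
/- The optimal value function satisfies the Bellman optimality equation: for every state s, V*(s) = ⨆_{a ∈ A} ( R(f(s,a), a) + γ · V*(f(s,a)) ). -/
theorem traj_succ_eq_traj_tail {S A : Type*} (f : S → A → S) (s : S) (a : ℕ → A) (t : ℕ) :
    traj f s a (t + 1) = traj f (f s (a 0)) (fun n => a (n + 1)) t := by
  induction t with
  | zero => rfl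
  | succ t ih =>
    change f (traj f s a (t + 1)) (a (t + 1)) = _
    rw [ih]
    rfl

theorem norm_discounted_reward_le {S A : Type*} (f : S → A → S) {R : S → A → ℝ} {γ C : ℝ}
    (hR : ∀ s a, |R s a| ≤ C) (hγ0 : 0 ≤ γ) (s : S) (a : ℕ → A) (t : ℕ) :
    ‖γ ^ t * R (traj f s a (t + 1)) (a t)‖ ≤ γ ^ t * C := by
  rw [Real.norm_eq_abs, abs_mul, abs_of_nonneg (pow_nonneg hγ0 t)]
  exact mul_le_mul_of_nonneg_left (hR _ _) (pow_nonneg hγ0 t)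

theorem summable_discounted_reward {S A : Type*} (f : S → A → S) {R : S → A → ℝ} {γ C : ℝ}
    (hR : ∀ s a, |R s a| ≤ C) (hγ0 : 0 ≤ γ) (hγ1 : γ < 1) (s : S) (a : ℕ → A) :
    Summable fun t : ℕ => γ ^ t * R (traj f s a (t + 1)) (a t) :=
  .of_norm_bounded ((summable_geometric_of_lt_one hγ0 hγ1).mul_right C)
    (norm_discounted_reward_le f hR hγ0 s a)

theorem bddAbove_range_ret {S A : Type*} (f : S → A → S) {R : S → A → ℝ} {γ C : ℝ}
    (hR : ∀ s a, |R s a| ≤ C) (hγ0 : 0 ≤ γ) (hγ1 : γ < 1) (s : S) :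
    BddAbove (Set.range (ret f R γ s)) := by
  refine ⟨∑' t : ℕ, γ ^ t * C, ?_⟩
  rintro _ ⟨a, rfl⟩
  exact (summable_discounted_reward f hR hγ0 hγ1 s a).tsum_le_tsum
    (fun t => (le_abs_self _).trans (norm_discounted_reward_le f hR hγ0 s a t))
    ((summable_geometric_of_lt_one hγ0 hγ1).mul_right C)

/-- Splitting the first reward off the discounted return. -/
theorem ret_eq_add_ret_tail {S A : Type*} (f : S → A → S) {R : S → A → ℝ} {γ C : ℝ}
    (hR : ∀ s a, |R s a| ≤ C) (hγ0 : 0 ≤ γ) (hγ1 : γ < 1) (s : S) (a : ℕ → A) :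
    ret f R γ s a =
      R (f s (a 0)) (a 0) + γ * ret f R γ (f s (a 0)) (fun n => a (n + 1)) := by
  rw [ret, (summable_discounted_reward f hR hγ0 hγ1 s a).tsum_eq_zero_add, ret, ← tsum_mul_left]
  congr 1
  · simp [traj]
  · refine tsum_congr fun t => ?_
    rw [traj_succ_eq_traj_tail f s a (t + 1), pow_succ']
    ring

/-- The optimal value function satisfies the Bellman optimality
equation: `V*(s) = ⨆ₐ (R(f(s,a), a) + γ V*(f(s,a)))`. -/
theorem bellman_optimality_V {S A : Type*} [Nonempty A]
    (f : S → A → S) (R : S → A → ℝ) (γ C : ℝ)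
    (hC : 0 ≤ C) (hR : ∀ s a, |R s a| ≤ C)
    (hγ0 : 0 ≤ γ) (hγ1 : γ < 1) (s : S) :
    Vstar f R γ s = ⨆ a : A, (R (f s a) a + γ * Vstar f R γ (f s a)) := by
  have hle (a : A) : R (f s a) a + γ * Vstar f R γ (f s a) ≤ Vstar f R γ s := by
    rw [← le_sub_iff_add_le', Vstar, Real.mul_iSup_of_nonneg hγ0]
    refine ciSup_le fun b => le_sub_iff_add_le'.mpr ?_
    let c : ℕ → A := fun t => Nat.casesOn t a b
    exact (ret_eq_add_ret_tail f hR hγ0 hγ1 s c).symm.trans_le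
      (le_ciSup (bddAbove_range_ret f hR hγ0 hγ1 s) c)
  refine le_antisymm (ciSup_le fun a => ?_) (ciSup_le hle)
  rw [ret_eq_add_ret_tail f hR hγ0 hγ1 s a]
  refine le_ciSup_of_le ⟨_, Set.forall_mem_range.mpr hle⟩ (a 0) ?_
  gcongr
  exact le_ciSup (bddAbove_range_ret f hR hγ0 hγ1 _) _
end
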